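/- arXiv:2404.18295 — 2 statements merged into one kernel-verified Lean document; each statement's English description precedes it below -/
import Mathlib

section
/- Let α ∈ ℝ and L > 0. Let U = ((u₁,u₂),(v₁,v₂)) and F = ((f₁,f₂),(g₁,g₂)) be pairs of functions on the tadpole graph such that u₁, f₁ are locally absolutely continuous with u₁', u₁'', f₁', f₁'' ∈ L²(0,∞), u₂, f₂ ∈ H²(0,L), v₁, g₁ ∈ H¹(0,∞), v₂, g₂ ∈ H¹(0,L), with the continuity conditions u₁(0)=u₂(0)=u₂(L), v₁(0)=v₂(0)=v₂(L), f₁(0)=f₂(0)=f₂(L), g₁(0)=g₂(0)=g₂(L), and with the transmission conditions u₁'(0)+u₂'(0)−u₂'(L) = α·v₁(0) and f₁'(0)+f₂'(0)−f₂'(L) = −α·g₁(0). Then Σ_{k=1,2}(⟨v_k',f_k'⟩ + ⟨u_k'',g_k⟩) = −Σ_{k=1,2}(⟨u_k',g_k'⟩ + ⟨v_k,f_k''⟩), where the inner products are taken in L²(0,∞) for k = 1 and in L²(0,L) for k = 2. (This expresses that the adjoint of the damped wave operator 𝒜_α is −𝒜_{−α} on its natural domain.) -/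
open MeasureTheory Set ComplexConjugate

/-- A pointwise derivative on a measurable set is a.e. strongly measurable there. -/
theorem aestronglyMeasurable_of_hasDerivAt {E : Type*} [NormedAddCommGroup E] [NormedSpace ℝ E]
    [CompleteSpace E] {s : Set ℝ} (hs : MeasurableSet s) {f f' : ℝ → E}
    (h : ∀ x ∈ s, HasDerivAt f (f' x) x) : AEStronglyMeasurable f' (volume.restrict s) := by
  refine (aestronglyMeasurable_deriv f (volume.restrict s)).congr ?_
  filter_upwards [ae_restrict_mem hs] with x hx using (h x hx).deriv

/-- The product of a square-integrable function with the conjugate of another is integrable. -/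
theorem integrable_mul_conj_of_integrable_sq {X : Type*} [MeasurableSpace X] {μ : Measure X}
    {p q : X → ℂ} (hpm : AEStronglyMeasurable p μ) (hqm : AEStronglyMeasurable q μ)
    (hp : Integrable (fun x => ‖p x‖ ^ 2) μ) (hq : Integrable (fun x => ‖q x‖ ^ 2) μ) :
    Integrable (fun x => p x * conj (q x)) μ := by
  have hp2 : MemLp p 2 μ := (memLp_two_iff_integrable_sq_norm hpm).2 hp
  have hq2 : MemLp (fun x => conj (q x)) 2 μ :=
    ((memLp_two_iff_integrable_sq_norm hqm).2 hq).star
  exact hp2.integrable_mul hq2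

/-- Integration by parts on `(0, ∞)` for functions in `H¹`. -/
theorem integral_Ioi_mul_conj_deriv_add {p p' q q' : ℝ → ℂ}
    (hp : ∀ x ∈ Ici (0 : ℝ), HasDerivWithinAt p (p' x) (Ici 0) x)
    (hq : ∀ x ∈ Ici (0 : ℝ), HasDerivWithinAt q (q' x) (Ici 0) x)
    (hpL2 : IntegrableOn (fun x => ‖p x‖ ^ 2) (Ioi 0))
    (hp'L2 : IntegrableOn (fun x => ‖p' x‖ ^ 2) (Ioi 0))
    (hqL2 : IntegrableOn (fun x => ‖q x‖ ^ 2) (Ioi 0))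
    (hq'L2 : IntegrableOn (fun x => ‖q' x‖ ^ 2) (Ioi 0)) :
    (∫ x in Ioi (0 : ℝ), p' x * conj (q x)) + (∫ x in Ioi (0 : ℝ), p x * conj (q' x))
      = -(p 0 * conj (q 0)) := by
  have hpd : ∀ x ∈ Ioi (0 : ℝ), HasDerivAt p (p' x) x := fun x hx =>
    (hp x (Ioi_subset_Ici_self hx)).hasDerivAt (Ici_mem_nhds hx)
  have hqd : ∀ x ∈ Ioi (0 : ℝ), HasDerivAt q (q' x) x := fun x hx =>
    (hq x (Ioi_subset_Ici_self hx)).hasDerivAt (Ici_mem_nhds hx)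
  have hpc : ContinuousOn p (Ici 0) := fun x hx => (hp x hx).continuousWithinAt
  have hqc : ContinuousOn q (Ici 0) := fun x hx => (hq x hx).continuousWithinAt
  have hpm := (hpc.mono Ioi_subset_Ici_self).aestronglyMeasurable (μ := volume) measurableSet_Ioi
  have hqm := (hqc.mono Ioi_subset_Ici_self).aestronglyMeasurable (μ := volume) measurableSet_Ioi
  have hp'm := aestronglyMeasurable_of_hasDerivAt measurableSet_Ioi hpd
  have hq'm := aestronglyMeasurable_of_hasDerivAt measurableSet_Ioi hqd
  have h₁ := integrable_mul_conj_of_integrable_sq hp'm hqm hp'L2 hqL2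
  have h₂ := integrable_mul_conj_of_integrable_sq hpm hq'm hpL2 hq'L2
  have h₀ := integrable_mul_conj_of_integrable_sq hpm hqm hpL2 hqL2
  have hd : ∀ x ∈ Ioi (0 : ℝ), HasDerivAt (fun x => p x * conj (q x))
      (p' x * conj (q x) + p x * conj (q' x)) x := fun x hx => (hpd x hx).mul (hqd x hx).star
  have hc : ContinuousOn (fun x => p x * conj (q x)) (Ici 0) := hpc.mul hqc.star
  rw [← integral_add h₁ h₂, integral_Ioi_of_hasDerivAt_of_tendsto
    (hc 0 self_mem_Ici) hd (h₁.add h₂)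
    (tendsto_zero_of_hasDerivAt_of_integrableOn_Ioi hd (h₁.add h₂) h₀), zero_sub]

/-- Integration by parts on `(0, L)` for functions in `H¹`. -/
theorem integral_Ioo_mul_conj_deriv_add {L : ℝ} (hL : 0 ≤ L) {p p' q q' : ℝ → ℂ}
    (hp : ∀ x ∈ Icc (0 : ℝ) L, HasDerivWithinAt p (p' x) (Icc 0 L) x)
    (hq : ∀ x ∈ Icc (0 : ℝ) L, HasDerivWithinAt q (q' x) (Icc 0 L) x)
    (hpL2 : IntegrableOn (fun x => ‖p x‖ ^ 2) (Ioo 0 L))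
    (hp'L2 : IntegrableOn (fun x => ‖p' x‖ ^ 2) (Ioo 0 L))
    (hqL2 : IntegrableOn (fun x => ‖q x‖ ^ 2) (Ioo 0 L))
    (hq'L2 : IntegrableOn (fun x => ‖q' x‖ ^ 2) (Ioo 0 L)) :
    (∫ x in Ioo (0 : ℝ) L, p' x * conj (q x)) + (∫ x in Ioo (0 : ℝ) L, p x * conj (q' x))
      = p L * conj (q L) - p 0 * conj (q 0) := by
  have hpd : ∀ x ∈ Ioo (0 : ℝ) L, HasDerivAt p (p' x) x := fun x hx =>
    (hp x (Ioo_subset_Icc_self hx)).hasDerivAt (Icc_mem_nhds hx.1 hx.2)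
  have hqd : ∀ x ∈ Ioo (0 : ℝ) L, HasDerivAt q (q' x) x := fun x hx =>
    (hq x (Ioo_subset_Icc_self hx)).hasDerivAt (Icc_mem_nhds hx.1 hx.2)
  have hpc : ContinuousOn p (Icc 0 L) := fun x hx => (hp x hx).continuousWithinAt
  have hqc : ContinuousOn q (Icc 0 L) := fun x hx => (hq x hx).continuousWithinAt
  have hpm := (hpc.mono Ioo_subset_Icc_self).aestronglyMeasurable (μ := volume) measurableSet_Ioo
  have hqm := (hqc.mono Ioo_subset_Icc_self).aestronglyMeasurable (μ := volume) measurableSet_Ioo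
  have hp'm := aestronglyMeasurable_of_hasDerivAt measurableSet_Ioo hpd
  have hq'm := aestronglyMeasurable_of_hasDerivAt measurableSet_Ioo hqd
  have h₁ := integrable_mul_conj_of_integrable_sq hp'm hqm hp'L2 hqL2
  have h₂ := integrable_mul_conj_of_integrable_sq hpm hq'm hpL2 hq'L2
  have hd : ∀ x ∈ Ioo (0 : ℝ) L, HasDerivAt (fun x => p x * conj (q x))
      (p' x * conj (q x) + p x * conj (q' x)) x := fun x hx => (hpd x hx).mul (hqd x hx).star
  have hc : ContinuousOn (fun x => p x * conj (q x)) (Icc 0 L) := hpc.mul hqc.star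
  have hi : IntervalIntegrable (fun x => p' x * conj (q x) + p x * conj (q' x)) volume 0 L :=
    (intervalIntegrable_iff_integrableOn_Ioo_of_le hL).2 (h₁.add h₂)
  rw [← integral_add h₁ h₂, ← integral_Ioc_eq_integral_Ioo, ← intervalIntegral.integral_of_le hL,
    intervalIntegral.integral_eq_sub_of_hasDerivAt_of_le hL hc hd hi]

/-- the adjoint identity
`Σ_k (⟨v_k',f_k'⟩ + ⟨u_k'',g_k⟩) = −Σ_k (⟨u_k',g_k'⟩ + ⟨v_k,f_k''⟩)`
for `U = (u,v)` in the domain of `𝒜_α` and `F = (f,g)` in the domain of `𝒜_{−α}`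
on the tadpole graph; it expresses `𝒜_α^* = −𝒜_{−α}`. -/
theorem stmt_2 (α L : ℝ) (hL : 0 < L)
    (u₁ u₁' u₁'' u₂ u₂' u₂'' v₁ v₁' v₂ v₂' : ℝ → ℂ)
    (f₁ f₁' f₁'' f₂ f₂' f₂'' g₁ g₁' g₂ g₂' : ℝ → ℂ)
    -- u₁, f₁ locally absolutely continuous with first and second derivatives in L²(0,∞)
    (hu₁ : ∀ x ∈ Ici (0 : ℝ), HasDerivWithinAt u₁ (u₁' x) (Ici 0) x)
    (hu₁d : ∀ x ∈ Ici (0 : ℝ), HasDerivWithinAt u₁' (u₁'' x) (Ici 0) x)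
    (hu₁'L2 : IntegrableOn (fun x => ‖u₁' x‖ ^ 2) (Ioi 0))
    (hu₁''L2 : IntegrableOn (fun x => ‖u₁'' x‖ ^ 2) (Ioi 0))
    (hf₁ : ∀ x ∈ Ici (0 : ℝ), HasDerivWithinAt f₁ (f₁' x) (Ici 0) x)
    (hf₁d : ∀ x ∈ Ici (0 : ℝ), HasDerivWithinAt f₁' (f₁'' x) (Ici 0) x)
    (hf₁'L2 : IntegrableOn (fun x => ‖f₁' x‖ ^ 2) (Ioi 0))
    (hf₁''L2 : IntegrableOn (fun x => ‖f₁'' x‖ ^ 2) (Ioi 0))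
    -- u₂, f₂ ∈ H²(0,L)
    (hu₂ : ∀ x ∈ Icc (0 : ℝ) L, HasDerivWithinAt u₂ (u₂' x) (Icc 0 L) x)
    (hu₂d : ∀ x ∈ Icc (0 : ℝ) L, HasDerivWithinAt u₂' (u₂'' x) (Icc 0 L) x)
    (hu₂L2 : IntegrableOn (fun x => ‖u₂ x‖ ^ 2) (Ioo 0 L))
    (hu₂'L2 : IntegrableOn (fun x => ‖u₂' x‖ ^ 2) (Ioo 0 L))
    (hu₂''L2 : IntegrableOn (fun x => ‖u₂'' x‖ ^ 2) (Ioo 0 L))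
    (hf₂ : ∀ x ∈ Icc (0 : ℝ) L, HasDerivWithinAt f₂ (f₂' x) (Icc 0 L) x)
    (hf₂d : ∀ x ∈ Icc (0 : ℝ) L, HasDerivWithinAt f₂' (f₂'' x) (Icc 0 L) x)
    (hf₂L2 : IntegrableOn (fun x => ‖f₂ x‖ ^ 2) (Ioo 0 L))
    (hf₂'L2 : IntegrableOn (fun x => ‖f₂' x‖ ^ 2) (Ioo 0 L))
    (hf₂''L2 : IntegrableOn (fun x => ‖f₂'' x‖ ^ 2) (Ioo 0 L))
    -- v₁, g₁ ∈ H¹(0,∞)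
    (hv₁ : ∀ x ∈ Ici (0 : ℝ), HasDerivWithinAt v₁ (v₁' x) (Ici 0) x)
    (hv₁L2 : IntegrableOn (fun x => ‖v₁ x‖ ^ 2) (Ioi 0))
    (hv₁'L2 : IntegrableOn (fun x => ‖v₁' x‖ ^ 2) (Ioi 0))
    (hg₁ : ∀ x ∈ Ici (0 : ℝ), HasDerivWithinAt g₁ (g₁' x) (Ici 0) x)
    (hg₁L2 : IntegrableOn (fun x => ‖g₁ x‖ ^ 2) (Ioi 0))
    (hg₁'L2 : IntegrableOn (fun x => ‖g₁' x‖ ^ 2) (Ioi 0))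
    -- v₂, g₂ ∈ H¹(0,L)
    (hv₂ : ∀ x ∈ Icc (0 : ℝ) L, HasDerivWithinAt v₂ (v₂' x) (Icc 0 L) x)
    (hv₂L2 : IntegrableOn (fun x => ‖v₂ x‖ ^ 2) (Ioo 0 L))
    (hv₂'L2 : IntegrableOn (fun x => ‖v₂' x‖ ^ 2) (Ioo 0 L))
    (hg₂ : ∀ x ∈ Icc (0 : ℝ) L, HasDerivWithinAt g₂ (g₂' x) (Icc 0 L) x)
    (hg₂L2 : IntegrableOn (fun x => ‖g₂ x‖ ^ 2) (Ioo 0 L))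
    (hg₂'L2 : IntegrableOn (fun x => ‖g₂' x‖ ^ 2) (Ioo 0 L))
    -- continuity conditions at the vertex
    (hcu : u₁ 0 = u₂ 0 ∧ u₂ 0 = u₂ L)
    (hcv : v₁ 0 = v₂ 0 ∧ v₂ 0 = v₂ L)
    (hcf : f₁ 0 = f₂ 0 ∧ f₂ 0 = f₂ L)
    (hcg : g₁ 0 = g₂ 0 ∧ g₂ 0 = g₂ L)
    -- transmission conditions
    (htru : u₁' 0 + u₂' 0 - u₂' L = (α : ℂ) * v₁ 0)
    (htrf : f₁' 0 + f₂' 0 - f₂' L = -(α : ℂ) * g₁ 0) :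
    (∫ x in Ioi (0 : ℝ), v₁' x * conj (f₁' x))
      + (∫ x in Ioo (0 : ℝ) L, v₂' x * conj (f₂' x))
      + (∫ x in Ioi (0 : ℝ), u₁'' x * conj (g₁ x))
      + (∫ x in Ioo (0 : ℝ) L, u₂'' x * conj (g₂ x))
    = -((∫ x in Ioi (0 : ℝ), u₁' x * conj (g₁' x))
        + (∫ x in Ioo (0 : ℝ) L, u₂' x * conj (g₂' x))
        + (∫ x in Ioi (0 : ℝ), v₁ x * conj (f₁'' x))
        + (∫ x in Ioo (0 : ℝ) L, v₂ x * conj (f₂'' x))) := by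
  have hv_half := integral_Ioi_mul_conj_deriv_add hv₁ hf₁d hv₁L2 hv₁'L2 hf₁'L2 hf₁''L2
  have hu_half := integral_Ioi_mul_conj_deriv_add hu₁d hg₁ hu₁'L2 hu₁''L2 hg₁L2 hg₁'L2
  have hv_loop := integral_Ioo_mul_conj_deriv_add hL.le hv₂ hf₂d hv₂L2 hv₂'L2 hf₂'L2 hf₂''L2
  have hu_loop := integral_Ioo_mul_conj_deriv_add hL.le hu₂d hg₂ hu₂'L2 hu₂''L2 hg₂L2 hg₂'L2
  have htrf' : conj (f₁' 0) + conj (f₂' 0) - conj (f₂' L) = -(α : ℂ) * conj (g₁ 0) := by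
    simpa using congrArg conj htrf
  rw [← hcv.2, ← hcv.1] at hv_loop
  rw [← hcg.2, ← hcg.1] at hu_loop
  linear_combination hv_half + hu_half + hv_loop + hu_loop - v₁ 0 * htrf' - conj (g₁ 0) * htru
end

section
/- Fix α ∈ (1,3) and L > 0; set ω = (1/L)·ln((1+α)/(3−α)) > 0, ν = 2π/L, and for n ∈ ℤ let z_n = −ω + inν, u_{1,n}(x) = e^{z_n x} on [0,∞), u_{2,n}(x) = ((3−α)/4)·e^{−z_n x} + ((1+α)/4)·e^{z_n x} on [0,L], and let Ψ_n = C_n·((u_{1,n},u_{2,n}),(z_n u_{1,n}, z_n u_{2,n})) with C_n > 0 chosen so that ‖Ψ_n‖_ℋ = 1. Then there exist constants 0 < A ≤ B such that for every finitely supported family (c_n)_{n∈ℤ} of complex numbers: A·Σ_n |c_n|² ≤ ‖Σ_n c_n·Ψ_n‖²_ℋ ≤ B·Σ_n |c_n|². (That is, the eigenfunctions (Ψ_n) of 𝒜_α associated to the discrete eigenvalues form a Riesz basis of the closed subspace of ℋ they span.) -/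
open MeasureTheory Set

/-- `ω = (1/L)·ln((1+α)/(3−α))` -/
noncomputable def om (α L : ℝ) : ℝ := Real.log ((1 + α) / (3 - α)) / L

/-- the discrete eigenvalue `z_n = −ω + i·n·(2π/L)` -/
noncomputable def zn (α L : ℝ) (n : ℤ) : ℂ :=
  ((-om α L : ℝ) : ℂ) + (((n : ℝ) * (2 * Real.pi / L) : ℝ) : ℂ) * Complex.I

/-- half-line component `u_{1,n}(x) = e^{z_n x}` -/
noncomputable def u1n (α L : ℝ) (n : ℤ) (x : ℝ) : ℂ := Complex.exp (zn α L n * (x : ℂ))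

/-- loop component `u_{2,n}(x) = ((3−α)/4)e^{−z_n x} + ((1+α)/4)e^{z_n x}` -/
noncomputable def u2n (α L : ℝ) (n : ℤ) (x : ℝ) : ℂ :=
  (((3 - α) / 4 : ℝ) : ℂ) * Complex.exp (-(zn α L n * (x : ℂ)))
    + (((1 + α) / 4 : ℝ) : ℂ) * Complex.exp (zn α L n * (x : ℂ))

/-- derivative of `u_{1,n}` -/
noncomputable def d1n (α L : ℝ) (n : ℤ) (x : ℝ) : ℂ := zn α L n * u1n α L n x

/-- derivative of `u_{2,n}` -/
noncomputable def d2n (α L : ℝ) (n : ℤ) (x : ℝ) : ℂ :=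
  -(zn α L n) * (((3 - α) / 4 : ℝ) : ℂ) * Complex.exp (-(zn α L n * (x : ℂ)))
    + zn α L n * (((1 + α) / 4 : ℝ) : ℂ) * Complex.exp (zn α L n * (x : ℂ))

/-- `‖Ψ_n‖²_ℋ/C_n²`: squared energy norm of the unnormalized eigenfunction -/
noncomputable def normSum (α L : ℝ) (n : ℤ) : ℝ :=
  (∫ x in Ioi (0 : ℝ), ‖d1n α L n x‖ ^ 2) + (∫ x in Ioo (0 : ℝ) L, ‖d2n α L n x‖ ^ 2)
    + (∫ x in Ioi (0 : ℝ), ‖zn α L n * u1n α L n x‖ ^ 2)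
    + (∫ x in Ioo (0 : ℝ) L, ‖zn α L n * u2n α L n x‖ ^ 2)

/-- `‖Σ_{n∈s} c_n Ψ_n‖²_ℋ`, the squared energy norm of a finite linear combination of the
normalized eigenfunctions `Ψ_n = C_n((u_{1,n},u_{2,n}),(z_n u_{1,n}, z_n u_{2,n}))` -/
noncomputable def comboNormSq (α L : ℝ) (C : ℤ → ℝ) (s : Finset ℤ) (c : ℤ → ℂ) : ℝ :=
  (∫ x in Ioi (0 : ℝ), ‖∑ n ∈ s, c n * ((C n : ℝ) : ℂ) * d1n α L n x‖ ^ 2)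
    + (∫ x in Ioo (0 : ℝ) L, ‖∑ n ∈ s, c n * ((C n : ℝ) : ℂ) * d2n α L n x‖ ^ 2)
    + (∫ x in Ioi (0 : ℝ), ‖∑ n ∈ s, c n * ((C n : ℝ) : ℂ) * (zn α L n * u1n α L n x)‖ ^ 2)
    + (∫ x in Ioo (0 : ℝ) L, ‖∑ n ∈ s, c n * ((C n : ℝ) : ℂ) * (zn α L n * u2n α L n x)‖ ^ 2)

noncomputable def trigSum (ν : ℝ) (s : Finset ℤ) (a : ℤ → ℂ) (x : ℝ) : ℂ :=
  ∑ n ∈ s, a n * Complex.exp ((n : ℂ) * ν * Complex.I * x)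

lemma continuous_trigSum (ν : ℝ) (s : Finset ℤ) (a : ℤ → ℂ) : Continuous (trigSum ν s a) := by
  unfold trigSum
  fun_prop

lemma norm_trigSum_le (ν : ℝ) (s : Finset ℤ) (a : ℤ → ℂ) (x : ℝ) :
    ‖trigSum ν s a x‖ ≤ ∑ n ∈ s, ‖a n‖ := by
  refine (norm_sum_le _ _).trans (Finset.sum_le_sum fun n _ => ?_)
  rw [norm_mul, Complex.norm_exp]
  simp

lemma trigSum_add_period {ν L : ℝ} (hper : Complex.exp (ν * L * Complex.I) = 1)
    (s : Finset ℤ) (a : ℤ → ℂ) (x : ℝ) : trigSum ν s a (x + L) = trigSum ν s a x := by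
  refine Finset.sum_congr rfl fun n _ => ?_
  have h : (n : ℂ) * ν * Complex.I * ((x + L : ℝ) : ℂ)
      = (n : ℂ) * ν * Complex.I * x + n * (ν * L * Complex.I) := by
    push_cast; ring
  rw [h, Complex.exp_add, Complex.exp_int_mul, hper, one_zpow, mul_one]

/-- Parseval's identity for trigonometric sums over one period. -/
lemma integral_norm_trigSum_sq {ν L : ℝ} (hν : ν ≠ 0) (hL : 0 < L)
    (hper : Complex.exp (ν * L * Complex.I) = 1) (s : Finset ℤ) (a : ℤ → ℂ) :
    ∫ x in Ioo (0 : ℝ) L, ‖trigSum ν s a x‖ ^ 2 = L * ∑ n ∈ s, ‖a n‖ ^ 2 := by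
  have hexp (k : ℤ) : ∫ x in (0 : ℝ)..L, Complex.exp ((k : ℂ) * ν * Complex.I * x)
      = if k = 0 then (L : ℂ) else 0 := by
    split_ifs with hk
    · simp [hk]
    · rw [integral_exp_mul_complex (by simp [hk, hν, Complex.I_ne_zero])]
      have h : (k : ℂ) * ν * Complex.I * L = k * (ν * L * Complex.I) := by ring
      rw [h, Complex.exp_int_mul, hper]
      simp
  have hsq (x : ℝ) : ((‖trigSum ν s a x‖ ^ 2 : ℝ) : ℂ)
      = ∑ n ∈ s, ∑ m ∈ s, a n * (starRingEnd ℂ) (a m) *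
          Complex.exp (((n - m : ℤ) : ℂ) * ν * Complex.I * x) := by
    rw [Complex.ofReal_pow, ← Complex.mul_conj', trigSum, map_sum, Finset.sum_mul_sum]
    refine Finset.sum_congr rfl fun n _ => Finset.sum_congr rfl fun m _ => ?_
    rw [map_mul, ← Complex.exp_conj, mul_mul_mul_comm, ← Complex.exp_add]
    congr 2
    simp
    ring
  rw [← integral_Ioc_eq_integral_Ioo, ← intervalIntegral.integral_of_le hL.le]
  apply Complex.ofReal_injective
  rw [← intervalIntegral.integral_ofReal]
  simp_rw [hsq]
  rw [intervalIntegral.integral_finsetSum fun n _ =>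
    (by fun_prop : Continuous _).intervalIntegrable _ _]
  rw [Complex.ofReal_mul, Complex.ofReal_sum, Finset.mul_sum]
  refine Finset.sum_congr rfl fun n hn => ?_
  rw [intervalIntegral.integral_finsetSum fun m _ =>
    (by fun_prop : Continuous _).intervalIntegrable _ _]
  simp_rw [intervalIntegral.integral_const_mul, hexp, sub_eq_zero]
  rw [Finset.sum_eq_single n]
  · rw [if_pos rfl, Complex.mul_conj']
    push_cast; ring
  · intro m _ hm
    rw [if_neg hm.symm, mul_zero]
  · exact fun h => absurd hn h

lemma integrableOn_Ioo_of_continuous {f : ℝ → ℝ} (hf : Continuous f) (a b : ℝ) :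
    IntegrableOn f (Ioo a b) :=
  (hf.integrableOn_Icc (a := a) (b := b)).mono_set Ioo_subset_Icc_self

/-- A damped trigonometric sum on the half-line: summing over periods reduces the integral to one
period. -/
lemma integral_Ioi_damped_trigSum {ν L ω : ℝ} (hω : 0 < ω) (hL : 0 < L)
    (hper : Complex.exp (ν * L * Complex.I) = 1) (s : Finset ℤ) (a : ℤ → ℂ) :
    (1 - Real.exp (-(2 * ω) * L)) *
        ∫ x in Ioi (0 : ℝ), Real.exp (-(2 * ω) * x) * ‖trigSum ν s a x‖ ^ 2
      = ∫ x in Ioo (0 : ℝ) L, Real.exp (-(2 * ω) * x) * ‖trigSum ν s a x‖ ^ 2 := by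
  set f : ℝ → ℝ := fun x => Real.exp (-(2 * ω) * x) * ‖trigSum ν s a x‖ ^ 2 with hf
  have hint : IntegrableOn f (Ioi 0) := by
    refine Integrable.mul_bdd (c := (∑ n ∈ s, ‖a n‖) ^ 2)
      (exp_neg_integrableOn_Ioi 0 (by positivity : 0 < 2 * ω)) ?_ ?_
    · exact ((continuous_trigSum ν s a).norm.pow 2).aestronglyMeasurable
    · refine .of_forall fun x => ?_
      rw [norm_pow, norm_norm]
      gcongr
      exact norm_trigSum_le ν s a x
  have hshift : ∫ x in Ioi L, f x = Real.exp (-(2 * ω) * L) * ∫ x in Ioi (0 : ℝ), f x := by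
    have h := (measurePreserving_add_right volume L).setIntegral_preimage_emb
      (measurableEmbedding_addRight L) f (Ioi L)
    rw [preimage_add_const_Ioi, sub_self] at h
    rw [← h, ← integral_const_mul]
    refine integral_congr_ae (.of_forall fun x => ?_)
    simp only [hf, trigSum_add_period hper, mul_add, Real.exp_add]
    ring
  have hsplit : ∫ x in Ioi (0 : ℝ), f x = (∫ x in Ioo 0 L, f x) + ∫ x in Ioi L, f x := by
    rw [← integral_Ioc_eq_integral_Ioo, ← setIntegral_union (Ioc_disjoint_Ioi le_rfl)
      measurableSet_Ioi (hint.mono_set Ioc_subset_Ioi_self)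
      (hint.mono_set (Ioi_subset_Ioi hL.le)), Ioc_union_Ioi_eq_Ioi hL.le]
  rw [sub_mul, one_mul, ← hshift, hsplit]
  ring

lemma norm_combination_sq_le (z w P Q : ℂ) :
    ‖z * P + w * Q‖ ^ 2 ≤ 2 * ‖z‖ ^ 2 * ‖P‖ ^ 2 + 2 * ‖w‖ ^ 2 * ‖Q‖ ^ 2 := by
  have h := norm_add_le (z * P) (w * Q)
  rw [norm_mul, norm_mul] at h
  nlinarith [norm_nonneg (z * P + w * Q), sq_nonneg (‖z‖ * ‖P‖ - ‖w‖ * ‖Q‖)]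

/-- Upper bound for the loop component, for weights bounded by `M`. -/
lemma integral_loop_le {ν L M : ℝ} (hν : ν ≠ 0) (hL : 0 < L)
    (hper : Complex.exp (ν * L * Complex.I) = 1) (s : Finset ℤ) (a : ℤ → ℂ) {z w : ℝ → ℂ}
    (hz : Continuous z) (hw : Continuous w)
    (hzM : ∀ x ∈ Ioo 0 L, ‖z x‖ ^ 2 ≤ M) (hwM : ∀ x ∈ Ioo 0 L, ‖w x‖ ^ 2 ≤ M) :
    ∫ x in Ioo (0 : ℝ) L, ‖z x * trigSum (-ν) s a x + w x * trigSum ν s a x‖ ^ 2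
      ≤ 4 * M * L * ∑ n ∈ s, ‖a n‖ ^ 2 := by
  have hper' : Complex.exp ((-ν : ℝ) * L * Complex.I) = 1 := by
    rw [Complex.ofReal_neg, neg_mul, neg_mul, Complex.exp_neg, hper, inv_one]
  have hP := continuous_trigSum ν s a
  have hQ := continuous_trigSum (-ν) s a
  calc ∫ x in Ioo (0 : ℝ) L, ‖z x * trigSum (-ν) s a x + w x * trigSum ν s a x‖ ^ 2
      ≤ ∫ x in Ioo (0 : ℝ) L,
          (2 * M * ‖trigSum (-ν) s a x‖ ^ 2 + 2 * M * ‖trigSum ν s a x‖ ^ 2) := by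
        refine setIntegral_mono_on (integrableOn_Ioo_of_continuous (by fun_prop) _ _)
          (integrableOn_Ioo_of_continuous (by fun_prop) _ _) measurableSet_Ioo fun x hx => ?_
        refine (norm_combination_sq_le _ _ _ _).trans ?_
        have h1 := hzM x hx
        have h2 := hwM x hx
        gcongr
    _ = 4 * M * L * ∑ n ∈ s, ‖a n‖ ^ 2 := by
        rw [integral_add (integrableOn_Ioo_of_continuous (by fun_prop) _ _)
          (integrableOn_Ioo_of_continuous (by fun_prop) _ _), integral_const_mul,
          integral_const_mul, integral_norm_trigSum_sq hν hL hper,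
          integral_norm_trigSum_sq (neg_ne_zero.mpr hν) hL hper']
        ring

lemma om_pos {α L : ℝ} (hα : α ∈ Ioo (1 : ℝ) 3) (hL : 0 < L) : 0 < om α L := by
  obtain ⟨h1, h3⟩ := hα
  refine div_pos (Real.log_pos ?_) hL
  rw [lt_div_iff₀ (by linarith)]
  linarith

lemma exp_zn_mul (α L : ℝ) (n : ℤ) (x : ℝ) :
    Complex.exp (zn α L n * x) = (Real.exp (-om α L * x) : ℝ) *
      Complex.exp ((n : ℂ) * (2 * Real.pi / L : ℝ) * Complex.I * x) := by
  rw [Complex.ofReal_exp, ← Complex.exp_add, zn]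
  congr 1
  push_cast; ring

lemma exp_neg_zn_mul (α L : ℝ) (n : ℤ) (x : ℝ) :
    Complex.exp (-(zn α L n * x)) = (Real.exp (om α L * x) : ℝ) *
      Complex.exp ((n : ℂ) * (-(2 * Real.pi / L) : ℝ) * Complex.I * x) := by
  rw [Complex.ofReal_exp, ← Complex.exp_add, zn]
  congr 1
  push_cast; ring

section Combination

variable (α L : ℝ) (s : Finset ℤ) (b : ℤ → ℂ) (x : ℝ)

lemma sum_mul_zn_mul_u1n :
    ∑ n ∈ s, b n * (zn α L n * u1n α L n x)
      = (Real.exp (-om α L * x) : ℝ) *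
        trigSum (2 * Real.pi / L) s (fun n => b n * zn α L n) x := by
  rw [trigSum, Finset.mul_sum]
  refine Finset.sum_congr rfl fun n _ => ?_
  rw [u1n, exp_zn_mul]
  ring

lemma sum_mul_zn_mul_u2n :
    ∑ n ∈ s, b n * (zn α L n * u2n α L n x)
      = ((3 - α) / 4 * Real.exp (om α L * x) : ℝ) *
          trigSum (-(2 * Real.pi / L)) s (fun n => b n * zn α L n) x
        + ((1 + α) / 4 * Real.exp (-om α L * x) : ℝ) *
          trigSum (2 * Real.pi / L) s (fun n => b n * zn α L n) x := by
  rw [trigSum, trigSum, Finset.mul_sum, Finset.mul_sum, ← Finset.sum_add_distrib]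
  refine Finset.sum_congr rfl fun n _ => ?_
  rw [u2n, exp_zn_mul, exp_neg_zn_mul, Complex.ofReal_mul, Complex.ofReal_mul]
  ring

lemma sum_mul_d2n :
    ∑ n ∈ s, b n * d2n α L n x
      = (-((3 - α) / 4 * Real.exp (om α L * x)) : ℝ) *
          trigSum (-(2 * Real.pi / L)) s (fun n => b n * zn α L n) x
        + ((1 + α) / 4 * Real.exp (-om α L * x) : ℝ) *
          trigSum (2 * Real.pi / L) s (fun n => b n * zn α L n) x := by
  rw [trigSum, trigSum, Finset.mul_sum, Finset.mul_sum, ← Finset.sum_add_distrib]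
  refine Finset.sum_congr rfl fun n _ => ?_
  rw [d2n, exp_zn_mul, exp_neg_zn_mul]
  push_cast
  ring

end Combination

/-- The energy norm of a combination is comparable to the `ℓ²` norm of its coefficients weighted
by `C n * z_n`. -/
lemma exists_comboNormSq_bounds {α L : ℝ} (hα : α ∈ Ioo (1 : ℝ) 3) (hL : 0 < L) :
    ∃ A B : ℝ, 0 < A ∧ 0 < B ∧ ∀ (C : ℤ → ℝ) (s : Finset ℤ) (c : ℤ → ℂ),
      A * (∑ n ∈ s, ‖c n‖ ^ 2 * (C n ^ 2 * ‖zn α L n‖ ^ 2)) ≤ comboNormSq α L C s c ∧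
      comboNormSq α L C s c ≤ B * (∑ n ∈ s, ‖c n‖ ^ 2 * (C n ^ 2 * ‖zn α L n‖ ^ 2)) := by
  set ω := om α L with hω_def
  set ν := 2 * Real.pi / L with hν_def
  have hω : 0 < ω := om_pos hα hL
  have hν : ν ≠ 0 := by positivity
  have hper : Complex.exp (ν * L * Complex.I) = 1 := by
    rw [← Complex.exp_two_pi_mul_I]
    congr 1
    rw [← Complex.ofReal_mul, hν_def, div_mul_cancel₀ _ hL.ne']
    push_cast; ring
  set q := Real.exp (-(2 * ω) * L) with hq_def
  have hq0 : 0 < q := Real.exp_pos _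
  have hq1 : 0 < 1 - q := by
    rw [sub_pos, hq_def, Real.exp_lt_one_iff]
    nlinarith
  set M := (Real.exp (ω * L)) ^ 2 with hM_def
  refine ⟨q * L, 2 * (L / (1 - q)) + 8 * M * L, by positivity, by positivity, fun C s c => ?_⟩
  set a : ℤ → ℂ := fun n => c n * (C n : ℂ) * zn α L n with ha_def
  have hsum : ∑ n ∈ s, ‖c n‖ ^ 2 * (C n ^ 2 * ‖zn α L n‖ ^ 2) = ∑ n ∈ s, ‖a n‖ ^ 2 := by
    refine Finset.sum_congr rfl fun n _ => ?_
    rw [ha_def]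
    simp only [norm_mul, mul_pow, Complex.norm_real, Real.norm_eq_abs, sq_abs, mul_assoc]
  rw [hsum]
  set S := ∑ n ∈ s, ‖a n‖ ^ 2 with hS_def
  have hS0 : 0 ≤ S := Finset.sum_nonneg fun n _ => by positivity
  set I := ∫ x in Ioi (0 : ℝ), Real.exp (-(2 * ω) * x) * ‖trigSum ν s a x‖ ^ 2 with hI_def
  have hsq (x : ℝ) : ‖((Real.exp (-ω * x) : ℝ) : ℂ) * trigSum ν s a x‖ ^ 2
      = Real.exp (-(2 * ω) * x) * ‖trigSum ν s a x‖ ^ 2 := by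
    rw [norm_mul, mul_pow, Complex.norm_real, Real.norm_eq_abs, sq_abs, ← Real.exp_nat_mul]
    congr 2
    push_cast; ring
  have hI1 : ∫ x in Ioi (0 : ℝ), ‖∑ n ∈ s, c n * (C n : ℂ) * (zn α L n * u1n α L n x)‖ ^ 2
      = I := by
    simp_rw [sum_mul_zn_mul_u1n, ← hω_def, ← hν_def, ← ha_def, hsq]
    rfl
  have hcombo : comboNormSq α L C s c
      = 2 * I + (∫ x in Ioo (0 : ℝ) L, ‖∑ n ∈ s, c n * (C n : ℂ) * d2n α L n x‖ ^ 2)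
        + ∫ x in Ioo (0 : ℝ) L, ‖∑ n ∈ s, c n * (C n : ℂ) * (zn α L n * u2n α L n x)‖ ^ 2 := by
    simp only [comboNormSq, d1n, hI1]
    ring
  have hIeq : (1 - q) * I
      = ∫ x in Ioo (0 : ℝ) L, Real.exp (-(2 * ω) * x) * ‖trigSum ν s a x‖ ^ 2 :=
    integral_Ioi_damped_trigSum hω hL hper s a
  have hP := continuous_trigSum ν s a
  have hparseval := integral_norm_trigSum_sq hν hL hper s a
  have hIlow : q * (L * S) ≤ (1 - q) * I := by
    rw [hIeq, ← hparseval, ← integral_const_mul]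
    refine setIntegral_mono_on (integrableOn_Ioo_of_continuous (by fun_prop) _ _)
      (integrableOn_Ioo_of_continuous (by fun_prop) _ _) measurableSet_Ioo fun x hx => ?_
    rw [hq_def]
    have h2 := hx.2
    gcongr ?_ * _
    exact Real.exp_le_exp.mpr (by nlinarith)
  have hIup : (1 - q) * I ≤ L * S := by
    rw [hIeq, ← hparseval]
    refine setIntegral_mono_on (integrableOn_Ioo_of_continuous (by fun_prop) _ _)
      (integrableOn_Ioo_of_continuous (by fun_prop) _ _) measurableSet_Ioo fun x hx => ?_
    refine mul_le_of_le_one_left (by positivity) (Real.exp_le_one_iff.mpr ?_)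
    nlinarith [hx.1]
  have hI0 : 0 ≤ I := integral_nonneg fun x => by positivity
  obtain ⟨hα1, hα3⟩ := hα
  have hpM : ∀ x ∈ Ioo 0 L, ((3 - α) / 4 * Real.exp (ω * x)) ^ 2 ≤ M := by
    intro x hx
    have h2 := hx.2
    have h3 : 0 ≤ (3 - α) / 4 := by linarith
    refine pow_le_pow_left₀ (by positivity) ?_ 2
    have : Real.exp (ω * x) ≤ Real.exp (ω * L) := by gcongr
    nlinarith [Real.exp_pos (ω * x)]
  have hqM : ∀ x ∈ Ioo 0 L, ((1 + α) / 4 * Real.exp (-ω * x)) ^ 2 ≤ M := by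
    intro x hx
    refine pow_le_pow_left₀ (by positivity) ?_ 2
    have : Real.exp (-ω * x) ≤ Real.exp (ω * L) := Real.exp_le_exp.mpr (by nlinarith [hx.1])
    nlinarith [Real.exp_pos (-ω * x)]
  have hd2 : ∫ x in Ioo (0 : ℝ) L, ‖∑ n ∈ s, c n * (C n : ℂ) * d2n α L n x‖ ^ 2
      ≤ 4 * M * L * S := by
    simp_rw [sum_mul_d2n, ← hω_def, ← hν_def, ← ha_def]
    refine integral_loop_le hν hL hper s a (by fun_prop) (by fun_prop) ?_ ?_
    · intro x hx
      rw [Complex.norm_real, Real.norm_eq_abs, sq_abs, neg_sq]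
      exact hpM x hx
    · intro x hx
      rw [Complex.norm_real, Real.norm_eq_abs, sq_abs]
      exact hqM x hx
  have hu2 : ∫ x in Ioo (0 : ℝ) L, ‖∑ n ∈ s, c n * (C n : ℂ) * (zn α L n * u2n α L n x)‖ ^ 2
      ≤ 4 * M * L * S := by
    simp_rw [sum_mul_zn_mul_u2n, ← hω_def, ← hν_def, ← ha_def]
    refine integral_loop_le hν hL hper s a (by fun_prop) (by fun_prop) ?_ ?_
    · intro x hx
      rw [Complex.norm_real, Real.norm_eq_abs, sq_abs]
      exact hpM x hx
    · intro x hx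
      rw [Complex.norm_real, Real.norm_eq_abs, sq_abs]
      exact hqM x hx
  have hd2' : 0 ≤ ∫ x in Ioo (0 : ℝ) L, ‖∑ n ∈ s, c n * (C n : ℂ) * d2n α L n x‖ ^ 2 :=
    integral_nonneg fun x => by positivity
  have hu2' : 0 ≤ ∫ x in Ioo (0 : ℝ) L,
      ‖∑ n ∈ s, c n * (C n : ℂ) * (zn α L n * u2n α L n x)‖ ^ 2 :=
    integral_nonneg fun x => by positivity
  rw [hcombo]
  constructor
  · nlinarith
  · have : I ≤ L / (1 - q) * S := by
      rw [div_mul_eq_mul_div, le_div_iff₀ hq1]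
      linarith
    linarith

lemma comboNormSq_singleton (α L : ℝ) (C : ℤ → ℝ) (n : ℤ) :
    comboNormSq α L C {n} 1 = C n ^ 2 * normSum α L n := by
  simp only [comboNormSq, normSum, Finset.sum_singleton, Pi.one_apply, one_mul, norm_mul, mul_pow,
    Complex.norm_real, Real.norm_eq_abs, sq_abs, integral_const_mul]
  ring

/-- the Riesz basis property of the normalized eigenfunctions `Ψ_n` of `𝒜_α`
(for `α ∈ (1,3)`): there are constants `0 < A ≤ B` with
`A·Σ|c_n|² ≤ ‖Σ c_n Ψ_n‖²_ℋ ≤ B·Σ|c_n|²` for every finitely supported family `(c_n)`. -/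
theorem stmt_17 (α L : ℝ) (hα : α ∈ Set.Ioo (1 : ℝ) 3) (hL : 0 < L)
    (C : ℤ → ℝ) (hC : ∀ n, 0 < C n)
    (hnorm : ∀ n, (C n) ^ 2 * normSum α L n = 1) :
    ∃ A B : ℝ, 0 < A ∧ A ≤ B ∧ ∀ (s : Finset ℤ) (c : ℤ → ℂ),
      A * (∑ n ∈ s, ‖c n‖ ^ 2) ≤ comboNormSq α L C s c ∧
      comboNormSq α L C s c ≤ B * (∑ n ∈ s, ‖c n‖ ^ 2) := by
  obtain ⟨A, B, hA, hB, h⟩ := exists_comboNormSq_bounds hα hL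
  have hweight (n : ℤ) : A * (C n ^ 2 * ‖zn α L n‖ ^ 2) ≤ 1 ∧
      1 ≤ B * (C n ^ 2 * ‖zn α L n‖ ^ 2) := by
    have hn := h C {n} 1
    rw [comboNormSq_singleton, hnorm n] at hn
    simpa using hn
  have hAB : A ≤ B := by
    have h0 := hweight 0
    by_contra! hlt
    have hpos : 0 ≤ C 0 ^ 2 * ‖zn α L 0‖ ^ 2 := by positivity
    nlinarith
  refine ⟨A / B, B / A, div_pos hA hB, ?_, fun s c => ⟨?_, ?_⟩⟩
  · exact ((div_le_one hB).mpr hAB).trans ((one_le_div hA).mpr hAB)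
  · refine le_trans ?_ (h C s c).1
    rw [div_mul_eq_mul_div, mul_div_assoc, Finset.sum_div]
    gcongr with n _
    rw [div_eq_mul_inv]
    gcongr
    rw [inv_le_iff_one_le_mul₀' hB]
    exact (hweight n).2
  · refine (h C s c).2.trans ?_
    rw [div_mul_eq_mul_div, mul_div_assoc, Finset.sum_div]
    gcongr with n _
    rw [div_eq_mul_inv]
    gcongr
    rw [← one_div, le_div_iff₀' hA]
    exact (hweight n).1
end
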